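/- arXiv:2204.04493 — 2 statements merged into one kernel-verified Lean document; each statement's English description precedes it below -/
import Mathlib

section
/- Classification of tight dense coding schemes (necessity direction). Let d ≥ 1. Suppose W ∈ M_d(ℂ)⊗M_d(ℂ) is a state, (N_i)_{i<d²} are channels M_d(ℂ) → M_d(ℂ) (encodings applied to the first tensor factor), and (G_j)_{j<d²} is a POVM on ℂ^d⊗ℂ^d, such that the dense coding equation Tr[ G_j · (N_i⊗id_{M_d(ℂ)})(W) ] = δ_{ij} holds for all i, j < d². Then W = |w⟩⟨w| for a maximally entangled unit vector w ∈ ℂ^d⊗ℂ^d, and there is a unitary error basis (U_i)_{i<d²} on ℂ^d such that N_i(ρ) = U_i ρ U_i† for all ρ ∈ M_d(ℂ) and G_i = |(U_i⊗I_d)w⟩⟨(U_i⊗I_d)w| for all i < d². -/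
noncomputable section

open Matrix Kronecker
open scoped ComplexOrder

namespace EntInvPaper

/-- The matrix algebra `M_n(ℂ)` with row/column index type `n`. -/
abbrev Mat (n : Type) : Type := Matrix n n ℂ

/-- The amplification `id_{M_t} ⊗ Φ` of a linear map between matrix algebras,
as a plain function on matrices. -/
def amplL {n m : Type} (t : Type) (Φ : Mat n →ₗ[ℂ] Mat m) (X : Mat (t × n)) : Mat (t × m) :=
  Matrix.of fun p q => Φ (Matrix.of fun x y => X (p.1, x) (q.1, y)) p.2 q.2

/-- The amplification `Φ ⊗ id_{M_t}` of a linear map between matrix algebras. -/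
def amplR {n m : Type} (t : Type) (Φ : Mat n →ₗ[ℂ] Mat m) (X : Mat (n × t)) : Mat (m × t) :=
  Matrix.of fun p q => Φ (Matrix.of fun x y => X (x, p.2) (y, q.2)) p.1 q.1

/-- Complete positivity: every amplification `id_{M_k} ⊗ Φ` preserves positive
semidefiniteness. -/
def IsCP {n m : Type} [Fintype n] [Fintype m] (Φ : Mat n →ₗ[ℂ] Mat m) : Prop :=
  ∀ (k : ℕ) (X : Mat (Fin k × n)), X.PosSemidef → (amplL (Fin k) Φ X).PosSemidef

/-- A channel is a completely positive trace-preserving linear map. -/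
def IsChannel {n m : Type} [Fintype n] [Fintype m] (Φ : Mat n →ₗ[ℂ] Mat m) : Prop :=
  IsCP Φ ∧ ∀ X : Mat n, (Φ X).trace = X.trace

/-- A state: a positive semidefinite matrix of trace one. -/
def IsState {n : Type} [Fintype n] (ρ : Mat n) : Prop :=
  ρ.PosSemidef ∧ ρ.trace = 1

/-- The outer product `|v⟩⟨v|`. -/
def outer {n : Type} (v : n → ℂ) : Mat n :=
  Matrix.vecMulVec v (star v)

/-- `x ⊗ W`, with the tensor factors regrouped as `(a × h₁) × h₂`. -/
def tensorState {a h₁ h₂ : Type} (x : Mat a) (W : Mat (h₁ × h₂)) : Mat ((a × h₁) × h₂) :=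
  Matrix.reindex (Equiv.prodAssoc a h₁ h₂).symm (Equiv.prodAssoc a h₁ h₂).symm (x ⊗ₖ W)

/-- Swap the two tensor factors of a bipartite operator. -/
def swapState {h₁ h₂ : Type} (W : Mat (h₁ × h₂)) : Mat (h₂ × h₁) :=
  Matrix.reindex (Equiv.prodComm h₁ h₂) (Equiv.prodComm h₁ h₂) W

/-- Partial trace over the first tensor factor. -/
def ptraceFst {p t : Type} [Fintype p] (X : Mat (p × t)) : Mat t :=
  Matrix.of fun s s' => ∑ u : p, X (u, s) (u, s')

/-- Partial trace over the second tensor factor. -/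
def ptraceSnd {s t : Type} [Fintype t] (X : Mat (s × t)) : Mat s :=
  Matrix.of fun i i' => ∑ k : t, X (i, k) (i', k)

/-- `N` is an entanglement-left inverse of `M` with respect to the resource state `W`:
`N((M ⊗ id)(x ⊗ W)) = x` for all `x`. -/
def EntLeftInv {a b h₁ h₂ : Type} (M : Mat (a × h₁) →ₗ[ℂ] Mat b)
    (N : Mat (b × h₂) →ₗ[ℂ] Mat a) (W : Mat (h₁ × h₂)) : Prop :=
  ∀ x : Mat a, N (amplR h₂ M (tensorState x W)) = x

/-- `N` is an entanglement-right inverse of `M` with respect to `W`: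
`M((N ⊗ id)(y ⊗ Wᵠ)) = y` for all `y`, where `Wᵠ` is `W` with the factors swapped. -/
def EntRightInv {a b h₁ h₂ : Type} (M : Mat (a × h₁) →ₗ[ℂ] Mat b)
    (N : Mat (b × h₂) →ₗ[ℂ] Mat a) (W : Mat (h₁ × h₂)) : Prop :=
  ∀ y : Mat b, M (amplR h₁ N (tensorState y (swapState W))) = y

/-- `M` is entanglement-reversible with respect to `W`. -/
def EntReversible {a b h₁ h₂ : Type} [Fintype a] [Fintype b] [Fintype h₁] [Fintype h₂]
    (M : Mat (a × h₁) →ₗ[ℂ] Mat b) (W : Mat (h₁ × h₂)) : Prop :=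
  ∃ N : Mat (b × h₂) →ₗ[ℂ] Mat a, IsChannel N ∧ EntLeftInv M N W

/-- `M` is entanglement-invertible with respect to `W`. -/
def EntInvertible {a b h₁ h₂ : Type} [Fintype a] [Fintype b] [Fintype h₁] [Fintype h₂]
    (M : Mat (a × h₁) →ₗ[ℂ] Mat b) (W : Mat (h₁ × h₂)) : Prop :=
  ∃ N : Mat (b × h₂) →ₗ[ℂ] Mat a, IsChannel N ∧ EntLeftInv M N W ∧ EntRightInv M N W

/-- The canonical maximally entangled unit vector `Ω = (1/√h) ∑ₖ eₖ ⊗ eₖ`. -/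
def omegaVec (h : ℕ) : Fin h × Fin h → ℂ :=
  fun p => if p.1 = p.2 then ((Real.sqrt h : ℝ) : ℂ)⁻¹ else 0

/-- The canonical maximally entangled state `|Ω⟩⟨Ω|`. -/
def canME (h : ℕ) : Mat (Fin h × Fin h) := outer (omegaVec h)

/-- The vector `w_ω = ∑ₖ eₖ ⊗ ω eₖ` associated to a linear map `ω : ℂ^{h₁} → ℂ^{h₂}`. -/
def pureVec {h₁ h₂ : Type} (ω : Matrix h₂ h₁ ℂ) : h₁ × h₂ → ℂ := fun p => ω p.2 p.1

/-- The pure state `|w_ω⟩⟨w_ω|` defined by `ω`. -/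
def pureState {h₁ h₂ : Type} (ω : Matrix h₂ h₁ ℂ) : Mat (h₁ × h₂) := outer (pureVec ω)

/-- `V` is a Stinespring dilation of the channel `M`, with environment the second
tensor factor `ℂ^e`: `V` is an isometry and `M z = Tr_{ℂ^e}(V z V†)`. -/
def IsDilation {a h b e : ℕ} (M : Mat (Fin a × Fin h) →ₗ[ℂ] Mat (Fin b))
    (V : Matrix (Fin b × Fin e) (Fin a × Fin h) ℂ) : Prop :=
  Vᴴ * V = 1 ∧ ∀ z : Mat (Fin a × Fin h), M z = ptraceSnd (V * z * Vᴴ)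

/-- Minimality of a dilation: the vectors `(⟨y| ⊗ I)Vξ` span the environment. -/
def IsMinimalDilation {a h b e : ℕ} (V : Matrix (Fin b × Fin e) (Fin a × Fin h) ℂ) : Prop :=
  Submodule.span ℂ { v : Fin e → ℂ |
    ∃ (y : Fin b → ℂ) (ξ : Fin a × Fin h → ℂ),
      v = fun f => ∑ j, (starRingEnd ℂ) (y j) * (V *ᵥ ξ) (j, f) } = ⊤

/-- The rearrangement `Ṽ` of `V : ℂ^a ⊗ ℂ^h → ℂ^b ⊗ ℂ^e`, with entries
`Ṽ_{(k,j),(i,f)} = V_{(j,f),(i,k)}`. -/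
def rearrange {a b h e : ℕ} (V : Matrix (Fin b × Fin e) (Fin a × Fin h) ℂ) :
    Matrix (Fin h × Fin b) (Fin a × Fin e) ℂ :=
  Matrix.of fun p q => V (p.2, q.2) (q.1, p.1)

/-- The candidate bi-isometry `S = (ω ⊗ I_b) · Ṽ · (I_a ⊗ κ)`. -/
def biIsometryCandidate {a b h e : ℕ} (ω : Mat (Fin h))
    (V : Matrix (Fin b × Fin e) (Fin a × Fin h) ℂ) (κ : Mat (Fin e)) :
    Matrix (Fin h × Fin b) (Fin a × Fin e) ℂ :=
  (ω ⊗ₖ (1 : Mat (Fin b))) * rearrange V * ((1 : Mat (Fin a)) ⊗ₖ κ)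

/-- The contraction `(⟨Φ| ⊗ I)X(|Φ⟩ ⊗ I)` of the first tensor factor of `X`
against the vector `Φ`. -/
def contract {p t : Type} [Fintype p] (Φ : p → ℂ) (X : Mat (p × t)) : Mat t :=
  Matrix.of fun s s' => ∑ u : p, ∑ u' : p, (starRingEnd ℂ) (Φ u) * X (u, s) (u', s') * Φ u'

/-- Conjugation `X ↦ C X C†` as a linear map. -/
def conjBy {p q : Type} [Fintype q] (C : Matrix p q ℂ) : Mat q →ₗ[ℂ] Mat p where
  toFun X := C * X * Cᴴ
  map_add' X Y := by
    show C * (X + Y) * Cᴴ = C * X * Cᴴ + C * Y * Cᴴ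
    rw [Matrix.mul_add, Matrix.add_mul]
  map_smul' c X := by
    show C * (c • X) * Cᴴ = c • (C * X * Cᴴ)
    rw [Matrix.mul_smul, Matrix.smul_mul]

end EntInvPaper

noncomputable section
open Matrix Kronecker
open scoped ComplexOrder
namespace EntInvPaper

section OuterProducts

variable {n : Type} [Fintype n]

lemma outer_apply {n : Type} (v : n → ℂ) (i j : n) : outer v i j = v i * star (v j) := rfl

lemma trace_outer (v : n → ℂ) : (outer v).trace = star v ⬝ᵥ v := by
  rw [outer, trace_vecMulVec, dotProduct_comm]

lemma mul_outer_mul_conjTranspose {m : Type} (B : Matrix m n ℂ) (v : n → ℂ) :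
    B * outer v * Bᴴ = outer (B *ᵥ v) := by
  rw [outer, outer, mul_vecMulVec, vecMulVec_mul, star_mulVec]

lemma trace_mul_outer (A : Mat n) (v : n → ℂ) : (A * outer v).trace = star v ⬝ᵥ (A *ᵥ v) := by
  rw [outer, mul_vecMulVec, trace_vecMulVec, dotProduct_comm]

lemma outer_mulVec (u v : n → ℂ) : outer u *ᵥ v = (star u ⬝ᵥ v) • u := by
  rw [outer, vecMulVec_mulVec, op_smul_eq_smul]

lemma posSemidef_outer (v : n → ℂ) : (outer v).PosSemidef :=
  posSemidef_vecMulVec_self_star v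

/-- The summands of a decomposition of a rank-one projection into outer products are all
proportional to the vector it projects onto. -/
lemma eq_smul_of_sum_outer_eq {ι : Type} [Fintype ι] {v : ι → n → ℂ} {g : n → ℂ}
    (hg : star g ⬝ᵥ g = 1) (h : ∑ k, outer (v k) = outer g) (k : ι) :
    v k = (star g ⬝ᵥ v k) • g := by
  set u := v k - (star g ⬝ᵥ v k) • g with hu
  have hgu : star g ⬝ᵥ u = 0 := by
    rw [hu, dotProduct_sub, dotProduct_smul, hg, smul_eq_mul, mul_one, sub_self]
  have hug : star u ⬝ᵥ g = 0 := by
    rw [star_dotProduct, hgu, star_zero]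
  have key : ∀ w : n → ℂ, star u ⬝ᵥ (outer w *ᵥ u) = star (star w ⬝ᵥ u) * (star w ⬝ᵥ u) := by
    intro w
    rw [outer_mulVec, dotProduct_smul, smul_eq_mul, mul_comm, star_dotProduct u w]
  have hsum : ∑ k, star (star (v k) ⬝ᵥ u) * (star (v k) ⬝ᵥ u) = 0 := by
    simp_rw [← key]
    rw [← dotProduct_sum, ← sum_mulVec, h, key, hgu, mul_zero]
  have hk := (Finset.sum_eq_zero_iff_of_nonneg
    (fun i _ => star_mul_self_nonneg (star (v i) ⬝ᵥ u))).1 hsum k (Finset.mem_univ k)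
  have hvu : star (v k) ⬝ᵥ u = 0 := by simpa using hk
  have huv : star u ⬝ᵥ v k = 0 := by
    rw [star_dotProduct, hvu, star_zero]
  have huu : star u ⬝ᵥ u = 0 := by
    conv_lhs => rw [hu, dotProduct_sub, dotProduct_smul, ← hu, huv, hug]
    simp
  exact sub_eq_zero.1 (dotProduct_star_self_eq_zero.1 huu)

end OuterProducts

section Measurement

variable {n ι : Type} [Fintype n] [Fintype ι]

lemma mul_eq_zero_of_trace_mul_eq_zero {A B : Mat n} (hA : A.PosSemidef) (hB : B.PosSemidef)
    (h : (A * B).trace = 0) : A * B = 0 := by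
  classical
  obtain ⟨m, v, rfl⟩ := posSemidef_iff_eq_sum_vecMulVec.1 hB
  change (A * ∑ k, outer (v k)).trace = 0 at h
  change A * ∑ k, outer (v k) = 0
  rw [Finset.mul_sum, trace_sum] at h
  simp_rw [trace_mul_outer] at h
  have hk := (Finset.sum_eq_zero_iff_of_nonneg
    (fun i _ => hA.dotProduct_mulVec_nonneg (v i))).1 h
  rw [Finset.mul_sum]
  refine Finset.sum_eq_zero fun k hkm => ?_
  rw [outer, mul_vecMulVec, (hA.dotProduct_mulVec_zero_iff _).1 (hk k hkm), zero_vecMulVec]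

/-- A measurement with as many outcomes as the dimension that perfectly discriminates as many
states consists of rank-one projections, which coincide with the states. -/
lemma exists_outer_of_perfect_discrimination [DecidableEq n] [DecidableEq ι]
    (hcard : Fintype.card n = Fintype.card ι)
    {G ρ : ι → Mat n} (hGpos : ∀ j, (G j).PosSemidef) (hGsum : ∑ j, G j = 1)
    (hρ : ∀ i, IsState (ρ i))
    (h : ∀ i j, (G j * ρ i).trace = if i = j then 1 else 0) :
    ∃ g : ι → n → ℂ, ∀ i, star (g i) ⬝ᵥ g i = 1 ∧ G i = outer (g i) ∧ ρ i = outer (g i) := by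
  have hoff : ∀ i j, i ≠ j → G j * ρ i = 0 := fun i j hij =>
    mul_eq_zero_of_trace_mul_eq_zero (hGpos j) (hρ i).1 (by rw [h, if_neg hij])
  have hdiag : ∀ i, G i * ρ i = ρ i := by
    intro i
    have := congrArg (· * ρ i) hGsum
    simp only [one_mul, Finset.sum_mul] at this
    rwa [Finset.sum_eq_single i (fun j _ hj => hoff i j hj.symm) (by simp)] at this
  have hvec : ∀ i, ∃ g : n → ℂ, star g ⬝ᵥ g = 1 ∧
      ∀ j, G j *ᵥ g = if i = j then g else 0 := by
    intro i
    have hne : ρ i ≠ 0 := by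
      intro h0
      have := (hρ i).2
      simp [h0] at this
    obtain ⟨x, hx⟩ : ∃ x, ρ i *ᵥ x ≠ 0 := by
      by_contra! hall
      exact hne (Matrix.ext_of_mulVec_single fun k => by rw [hall, zero_mulVec])
    set y := ρ i *ᵥ x with hy
    have hpos : 0 < star y ⬝ᵥ y := dotProduct_star_self_pos_iff.2 hx
    obtain ⟨hre, him⟩ := Complex.pos_iff.1 hpos
    have hyy : star y ⬝ᵥ y = ((star y ⬝ᵥ y).re : ℂ) := Complex.ext rfl him.symm
    set r := (star y ⬝ᵥ y).re
    refine ⟨(((Real.sqrt r)⁻¹ : ℝ) : ℂ) • y, ?_, fun j => ?_⟩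
    · rw [star_smul, smul_dotProduct, dotProduct_smul, hyy]
      simp only [smul_eq_mul, Complex.star_def, Complex.conj_ofReal]
      norm_cast
      have := Real.mul_self_sqrt hre.le
      have h0 := (Real.sqrt_pos.2 hre).ne'
      field_simp
      rw [sq, this]
    · rw [mulVec_smul, hy, mulVec_mulVec]
      split_ifs with hij
      · rw [← hij, hdiag]
      · rw [hoff i j hij, zero_mulVec, smul_zero]
  choose g hg1 hgG using hvec
  have horth : ∀ i j, star (g i) ⬝ᵥ g j = if i = j then 1 else 0 := by
    intro i j
    split_ifs with hij
    · rw [← hij, hg1]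
    · have h1 : g i = G i *ᵥ g i := by simp [hgG]
      rw [h1, star_mulVec, (hGpos i).1.eq, ← dotProduct_mulVec, hgG, if_neg (Ne.symm hij),
        dotProduct_zero]
  let V : Matrix n ι ℂ := Matrix.of fun x i => g i x
  have hVV : Vᴴ * V = 1 := by
    ext i j
    rw [one_apply, ← horth]
    rfl
  have hVV' : V * Vᴴ = 1 := (mul_eq_one_comm_of_card_eq _ _ _ hcard.symm).1 hVV
  have hsum : ∑ i, outer (g i) = 1 := by
    rw [← hVV']
    ext x y
    simp [Matrix.sum_apply, outer_apply, mul_apply, V]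
  have hG : ∀ i, G i = outer (g i) := by
    intro i
    rw [← mul_one (G i), ← hsum, Finset.mul_sum, Finset.sum_eq_single i]
    · rw [outer, mul_vecMulVec, hgG, if_pos rfl]
    · intro j _ hj
      rw [outer, mul_vecMulVec, hgG, if_neg hj, zero_vecMulVec]
    · simp
  refine ⟨g, fun i => ⟨hg1 i, hG i, ?_⟩⟩
  have h1 : ρ i = G i * ρ i * G i := by
    have := congrArg conjTranspose (hdiag i)
    rw [conjTranspose_mul, (hGpos i).1.eq, (hρ i).1.1.eq] at this
    rw [hdiag, this]
  have h2 : ρ i = (star (g i) ⬝ᵥ (ρ i *ᵥ g i)) • outer (g i) := by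
    conv_lhs => rw [h1, hG, outer, Matrix.mul_assoc, mul_vecMulVec, vecMulVec_mul_vecMulVec]
    rw [vecMulVec_smul, outer]
  have h3 := congrArg trace h2
  rw [(hρ i).2, trace_smul, trace_outer, hg1, smul_eq_mul, mul_one] at h3
  rw [← h3, one_smul] at h2
  exact h2

end Measurement

section Channels

variable {d : ℕ}

/-- A completely positive map has a Kraus decomposition. -/
lemma IsCP.exists_kraus {N : Mat (Fin d) →ₗ[ℂ] Mat (Fin d)} (hN : IsCP N) :
    ∃ (m : ℕ) (A : Fin m → Mat (Fin d)), ∀ X, N X = ∑ a, A a * X * (A a)ᴴ := by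
  obtain ⟨m, b, hb⟩ := posSemidef_iff_eq_sum_vecMulVec.1
    (hN d _ (posSemidef_outer fun p : Fin d × Fin d => if p.1 = p.2 then 1 else 0))
  have hchoi : ∀ x y p q, N (Matrix.single x y 1) p q = ∑ a, b a (x, p) * star (b a (y, q)) := by
    intro x y p q
    have := congrFun (congrFun hb (x, p)) (y, q)
    simp only [amplL, of_apply, Matrix.sum_apply, vecMulVec_apply, Pi.star_apply] at this
    rw [← this]
    refine congrArg (fun Z => N Z p q) ?_
    ext s t
    by_cases hx : x = s <;> simp [single_apply, outer_apply, hx]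
  refine ⟨m, fun a => Matrix.of fun p x => b a (x, p), fun X => ?_⟩
  conv_lhs => rw [matrix_eq_sum_single X]
  ext p q
  have hs : ∀ x y, Matrix.single x y (X x y) = X x y • Matrix.single x y (1 : ℂ) := by
    intro x y
    rw [smul_single, smul_eq_mul, mul_one]
  simp only [hs, map_sum, map_smul, Matrix.sum_apply, Matrix.smul_apply, hchoi, mul_apply, of_apply,
    conjTranspose_apply, smul_eq_mul, Finset.mul_sum, Finset.sum_mul]
  rw [Finset.sum_comm_cycle]
  refine Finset.sum_congr rfl fun a _ => ?_
  rw [Finset.sum_comm]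
  refine Finset.sum_congr rfl fun y _ => Finset.sum_congr rfl fun x _ => ?_
  ring

lemma amplR_eq_sum_of_kraus {ι : Type} [Fintype ι] {N : Mat (Fin d) →ₗ[ℂ] Mat (Fin d)}
    {A : ι → Mat (Fin d)} (hA : ∀ X, N X = ∑ a, A a * X * (A a)ᴴ) (W : Mat (Fin d × Fin d)) :
    amplR (Fin d) N W =
      ∑ a, (A a ⊗ₖ (1 : Mat (Fin d))) * W * (A a ⊗ₖ (1 : Mat (Fin d)))ᴴ := by
  ext ⟨p, s⟩ ⟨q, t⟩
  simp only [amplR, of_apply, hA, Matrix.sum_apply]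
  refine Finset.sum_congr rfl fun a _ => ?_
  simp [mul_apply, conjTranspose_apply, Fintype.sum_prod_type, kroneckerMap_apply, one_apply,
    apply_ite (starRingEnd ℂ)]

lemma IsCP.posSemidef_amplR {N : Mat (Fin d) →ₗ[ℂ] Mat (Fin d)} (hN : IsCP N)
    {W : Mat (Fin d × Fin d)} (hW : W.PosSemidef) : (amplR (Fin d) N W).PosSemidef := by
  obtain ⟨m, A, hA⟩ := hN.exists_kraus
  rw [amplR_eq_sum_of_kraus hA]
  exact posSemidef_sum _ fun a _ => hW.mul_mul_conjTranspose_same _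

lemma ptraceFst_amplR {N : Mat (Fin d) →ₗ[ℂ] Mat (Fin d)} (hN : ∀ X, (N X).trace = X.trace)
    (W : Mat (Fin d × Fin d)) : ptraceFst (amplR (Fin d) N W) = ptraceFst W := by
  ext s t
  exact hN (Matrix.of fun x y => W (x, s) (y, t))

lemma trace_ptraceFst (W : Mat (Fin d × Fin d)) : (ptraceFst W).trace = W.trace := by
  simp only [ptraceFst, trace, diag_apply, of_apply, Fintype.sum_prod_type]
  exact Finset.sum_comm

lemma IsChannel.isState_amplR {N : Mat (Fin d) →ₗ[ℂ] Mat (Fin d)} (hN : IsChannel N)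
    {W : Mat (Fin d × Fin d)} (hW : IsState W) : IsState (amplR (Fin d) N W) :=
  ⟨hN.1.posSemidef_amplR hW.1, by
    rw [← trace_ptraceFst, ptraceFst_amplR hN.2, trace_ptraceFst, hW.2]⟩

/-- The matrix whose entries are the coordinates of a bipartite vector. -/
def coeffMatrix (w : Fin d × Fin d → ℂ) : Mat (Fin d) := Matrix.of fun p q => w (p, q)

lemma coeffMatrix_kronecker_mulVec (A : Mat (Fin d)) (w : Fin d × Fin d → ℂ) :
    coeffMatrix ((A ⊗ₖ (1 : Mat (Fin d))) *ᵥ w) = A * coeffMatrix w := by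
  ext p q
  simp [coeffMatrix, mulVec, dotProduct, mul_apply, Fintype.sum_prod_type, kroneckerMap_apply,
    one_apply]

lemma coeffMatrix_smul (c : ℂ) (w : Fin d × Fin d → ℂ) :
    coeffMatrix (c • w) = c • coeffMatrix w := rfl

lemma ptraceFst_outer (w : Fin d × Fin d → ℂ) :
    ptraceFst (outer w) = ((coeffMatrix w)ᴴ * coeffMatrix w)ᵀ := by
  ext s t
  simp [ptraceFst, outer_apply, coeffMatrix, mul_apply, mul_comm]

lemma ptraceSnd_outer (w : Fin d × Fin d → ℂ) :
    ptraceSnd (outer w) = coeffMatrix w * (coeffMatrix w)ᴴ := by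
  ext s t
  simp [ptraceSnd, outer_apply, coeffMatrix, mul_apply]

lemma conjTranspose_mul_coeffMatrix {w : Fin d × Fin d → ℂ}
    (h : ptraceFst (outer w) = ((d : ℂ))⁻¹ • (1 : Mat (Fin d))) :
    (coeffMatrix w)ᴴ * coeffMatrix w = ((d : ℂ))⁻¹ • (1 : Mat (Fin d)) := by
  rw [ptraceFst_outer] at h
  simpa using congrArg transpose h

lemma ptraceSnd_outer_eq_of_ptraceFst_outer_eq (hd : d ≠ 0) {w : Fin d × Fin d → ℂ}
    (h : ptraceFst (outer w) = ((d : ℂ))⁻¹ • (1 : Mat (Fin d))) :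
    ptraceSnd (outer w) = ((d : ℂ))⁻¹ • (1 : Mat (Fin d)) := by
  have hd' : (d : ℂ) ≠ 0 := Nat.cast_ne_zero.2 hd
  have h1 : ((d : ℂ) • (coeffMatrix w)ᴴ) * coeffMatrix w = 1 := by
    rw [Matrix.smul_mul, conjTranspose_mul_coeffMatrix h, smul_smul, mul_inv_cancel₀ hd', one_smul]
  have h2 := mul_eq_one_comm.1 h1
  rw [ptraceSnd_outer, ← h2, Matrix.mul_smul, smul_smul, inv_mul_cancel₀ hd', one_smul]

lemma dotProduct_kronecker_mulVec (A : Mat (Fin d)) (w : Fin d × Fin d → ℂ) :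
    star w ⬝ᵥ ((A ⊗ₖ (1 : Mat (Fin d))) *ᵥ w) = (A * ptraceSnd (outer w)).trace := by
  simp only [dotProduct, mulVec, trace, diag_apply, mul_apply, ptraceSnd, outer_apply, of_apply,
    Fintype.sum_prod_type, kroneckerMap_apply, one_apply, Pi.star_apply, mul_ite, ite_mul, mul_one,
    mul_zero, zero_mul, Finset.sum_ite_eq, Finset.mem_univ, if_true, Finset.mul_sum]
  refine Finset.sum_congr rfl fun p _ => ?_
  rw [Finset.sum_comm]
  refine Finset.sum_congr rfl fun q _ => Finset.sum_congr rfl fun s _ => ?_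
  ring

/-- A channel sending half of some state to a maximally entangled pure state is unitary. -/
lemma IsChannel.exists_unitary (hd : d ≠ 0) {N : Mat (Fin d) →ₗ[ℂ] Mat (Fin d)}
    (hN : IsChannel N) {W : Mat (Fin d × Fin d)} (hW : W.PosSemidef) {g : Fin d × Fin d → ℂ}
    (hg : star g ⬝ᵥ g = 1) (hNW : amplR (Fin d) N W = outer g)
    (hgd : ptraceFst (outer g) = ((d : ℂ))⁻¹ • (1 : Mat (Fin d))) :
    ∃ U ∈ unitaryGroup (Fin d) ℂ, ∀ X, N X = U * X * Uᴴ := by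
  have hd' : (d : ℂ) ≠ 0 := Nat.cast_ne_zero.2 hd
  obtain ⟨m, A, hA⟩ := hN.1.exists_kraus
  obtain ⟨l, w, hw⟩ := posSemidef_iff_eq_sum_vecMulVec.1 hW
  have hdecomp : ∑ ak : Fin m × Fin l, outer ((A ak.1 ⊗ₖ (1 : Mat (Fin d))) *ᵥ w ak.2)
      = outer g := by
    rw [← hNW, amplR_eq_sum_of_kraus hA, Fintype.sum_prod_type]
    refine Finset.sum_congr rfl fun a _ => ?_
    rw [hw, Finset.mul_sum, Finset.sum_mul]
    exact Finset.sum_congr rfl fun k _ => (mul_outer_mul_conjTranspose _ _).symm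
  have hprop := eq_smul_of_sum_outer_eq hg hdecomp
  set c : Fin m × Fin l → ℂ := fun ak => star g ⬝ᵥ ((A ak.1 ⊗ₖ (1 : Mat (Fin d))) *ᵥ w ak.2)
  set Γ := coeffMatrix g
  have hAM : ∀ a k, A a * coeffMatrix (w k) = c (a, k) • Γ := by
    intro a k
    rw [← coeffMatrix_kronecker_mulVec, hprop (a, k), coeffMatrix_smul]
  have hΓ : ((d : ℂ) • Γᴴ) * Γ = 1 := by
    rw [Matrix.smul_mul, conjTranspose_mul_coeffMatrix hgd, smul_smul, mul_inv_cancel₀ hd',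
      one_smul]
  obtain ⟨⟨a₀, k⟩, hc⟩ : ∃ ak, c ak ≠ 0 := by
    by_contra! hall
    have h0 : outer g = 0 := by
      rw [← hdecomp]
      refine Finset.sum_eq_zero fun ak _ => ?_
      rw [hprop ak]
      change outer (c ak • g) = 0
      rw [hall, zero_smul, outer, zero_vecMulVec]
    rw [← trace_outer, h0, trace_zero] at hg
    exact zero_ne_one hg
  have hleft : (((c (a₀, k))⁻¹ * (d : ℂ)) • Γᴴ * A a₀) * coeffMatrix (w k) = 1 := by
    rw [Matrix.mul_assoc, hAM, Matrix.mul_smul, mul_smul, Matrix.smul_mul, hΓ, smul_smul,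
      mul_inv_cancel₀ hc, one_smul]
  set R := ((c (a₀, k))⁻¹ * (d : ℂ)) • Γᴴ * A a₀
  have hright : coeffMatrix (w k) * R = 1 := mul_eq_one_comm.1 hleft
  have hAT : ∀ a, A a = c (a, k) • (Γ * R) := by
    intro a
    rw [← Matrix.smul_mul, ← hAM, Matrix.mul_assoc, hright, Matrix.mul_one]
  set r : ℝ := ∑ a, Complex.normSq (c (a, k))
  have hr : 0 ≤ r := Finset.sum_nonneg fun a _ => Complex.normSq_nonneg _
  have hNU : ∀ X, N X =
      ((Real.sqrt r : ℂ) • (Γ * R)) * X * ((Real.sqrt r : ℂ) • (Γ * R))ᴴ := by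
    intro X
    rw [hA]
    have hterm : ∀ a, A a * X * (A a)ᴴ =
        (Complex.normSq (c (a, k)) : ℂ) • ((Γ * R) * X * (Γ * R)ᴴ) := by
      intro a
      rw [hAT, conjTranspose_smul, Matrix.mul_smul, Matrix.smul_mul, Matrix.smul_mul, smul_smul,
        Complex.star_def, Complex.normSq_eq_conj_mul_self]
    simp_rw [hterm]
    rw [← Finset.sum_smul, conjTranspose_smul, Matrix.mul_smul, Matrix.smul_mul, Matrix.smul_mul,
      smul_smul, Complex.star_def, Complex.conj_ofReal, ← Complex.ofReal_mul,
      Real.mul_self_sqrt hr, Complex.ofReal_sum]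
  refine ⟨_, ?_, hNU⟩
  rw [mem_unitaryGroup_iff', star_eq_conjTranspose, ext_iff_trace_mul_right]
  intro X
  rw [Matrix.one_mul, ← hN.2 X, hNU, Matrix.mul_assoc, trace_mul_comm]

end Channels

/-- **Werner's classification of tight dense coding schemes (necessity).**
If `W` is a state on `M_d(ℂ) ⊗ M_d(ℂ)`, the `(N i)` are encoding channels on
`M_d(ℂ)` and `(G j)` is a POVM on `ℂ^d ⊗ ℂ^d` such that the dense coding equation
`Tr[G j · (N i ⊗ id)(W)] = δᵢⱼ` holds, then `W` is a maximally entangled pure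
state, the `N i` are the unitary channels of a unitary error basis `(Uᵢ)`, and
`G i = |(Uᵢ ⊗ I)w⟩⟨(Uᵢ ⊗ I)w|`. -/
theorem tight_dense_coding_classification
    (d : ℕ) (hd : 1 ≤ d)
    (W : Mat (Fin d × Fin d)) (hW : IsState W)
    (N : Fin (d ^ 2) → (Mat (Fin d) →ₗ[ℂ] Mat (Fin d)))
    (hN : ∀ i, IsChannel (N i))
    (G : Fin (d ^ 2) → Mat (Fin d × Fin d))
    (hGpos : ∀ j, (G j).PosSemidef) (hGsum : ∑ j, G j = 1)
    (hdc : ∀ i j, (G j * amplR (Fin d) (N i) W).trace = if i = j then 1 else 0) :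
    ∃ w : Fin d × Fin d → ℂ,
      star w ⬝ᵥ w = 1 ∧
      ptraceSnd (outer w) = ((d : ℂ))⁻¹ • (1 : Mat (Fin d)) ∧
      W = outer w ∧
      ∃ U : Fin (d ^ 2) → Mat (Fin d),
        (∀ i, U i ∈ Matrix.unitaryGroup (Fin d) ℂ) ∧
        (∀ i j, ((d : ℂ))⁻¹ * ((U i)ᴴ * U j).trace = if i = j then 1 else 0) ∧
        (∀ i (ρ : Mat (Fin d)), N i ρ = U i * ρ * (U i)ᴴ) ∧
        (∀ i, G i = outer ((U i ⊗ₖ (1 : Mat (Fin d))) *ᵥ w)) := by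
  have hd0 : d ≠ 0 := by omega
  have hdC : (d : ℂ) ≠ 0 := Nat.cast_ne_zero.2 hd0
  obtain ⟨g, hg⟩ := exists_outer_of_perfect_discrimination
    (by simp [sq]) hGpos hGsum (fun i => (hN i).isState_amplR hW) hdc
  have hmarg : ptraceFst W = ((d : ℂ))⁻¹ • (1 : Mat (Fin d)) := by
    have hsum : ∑ i, amplR (Fin d) (N i) W = 1 := by
      rw [← hGsum]
      exact Finset.sum_congr rfl fun i _ => (hg i).2.2.trans (hg i).2.1.symm
    have hpt : ∑ i, ptraceFst (amplR (Fin d) (N i) W) = (d : ℂ) • (1 : Mat (Fin d)) := by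
      ext s t
      have hsumapp := fun u => congrFun (congrFun hsum (u, s)) (u, t)
      simp only [Matrix.sum_apply] at hsumapp
      simp only [ptraceFst, Matrix.sum_apply, of_apply]
      rw [Finset.sum_comm]
      simp only [hsumapp]
      simp [one_apply]
    simp only [ptraceFst_amplR (hN _).2, Finset.sum_const, Finset.card_univ, Fintype.card_fin]
      at hpt
    rw [← Nat.cast_smul_eq_nsmul ℂ, Nat.cast_pow] at hpt
    have := congrArg (((d : ℂ) ^ 2)⁻¹ • ·) hpt
    simp only [smul_smul] at this
    rw [inv_mul_cancel₀ (pow_ne_zero 2 hdC), one_smul] at this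
    rw [this]
    congr 1
    field_simp
  have hU : ∀ i, ∃ U ∈ unitaryGroup (Fin d) ℂ, ∀ X, N i X = U * X * Uᴴ := fun i =>
    (hN i).exists_unitary hd0 hW.1 (hg i).1 (hg i).2.2 (by
      rw [← (hg i).2.2, ptraceFst_amplR (hN i).2, hmarg])
  choose U hUmem hNU using hU
  have hampl : ∀ i, amplR (Fin d) (N i) W =
      (U i ⊗ₖ (1 : Mat (Fin d))) * W * (U i ⊗ₖ (1 : Mat (Fin d)))ᴴ := by
    intro i
    have := amplR_eq_sum_of_kraus (ι := Unit) (N := N i) (A := fun _ => U i)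
      (fun X => by simp [hNU]) W
    simpa using this
  have hUU : ∀ i, (U i)ᴴ * U i = 1 := fun i => mem_unitaryGroup_iff'.1 (hUmem i)
  let i₀ : Fin (d ^ 2) := ⟨0, by positivity⟩
  set w := (U i₀ ⊗ₖ (1 : Mat (Fin d)))ᴴ *ᵥ g i₀ with hw
  have hWw : W = outer w := by
    have hK : (U i₀ ⊗ₖ (1 : Mat (Fin d)))ᴴ * (U i₀ ⊗ₖ (1 : Mat (Fin d))) = 1 := by
      rw [conjTranspose_kronecker, ← mul_kronecker_mul, hUU, conjTranspose_one, Matrix.one_mul,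
        one_kronecker_one]
    rw [hw, ← mul_outer_mul_conjTranspose, ← (hg i₀).2.2, hampl, conjTranspose_conjTranspose]
    simp only [Matrix.mul_assoc, hK, Matrix.mul_one]
    rw [← Matrix.mul_assoc, hK, Matrix.one_mul]
  have hw1 : star w ⬝ᵥ w = 1 := by rw [← trace_outer, ← hWw, hW.2]
  have hwsnd : ptraceSnd (outer w) = ((d : ℂ))⁻¹ • (1 : Mat (Fin d)) :=
    ptraceSnd_outer_eq_of_ptraceFst_outer_eq hd0 (by rw [← hWw, hmarg])
  have hNW : ∀ i, amplR (Fin d) (N i) W = outer ((U i ⊗ₖ (1 : Mat (Fin d))) *ᵥ w) := by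
    intro i
    rw [hampl, hWw, mul_outer_mul_conjTranspose]
  have hGw : ∀ i, G i = outer ((U i ⊗ₖ (1 : Mat (Fin d))) *ᵥ w) := fun i => by
    rw [← hNW, (hg i).2.1, (hg i).2.2]
  refine ⟨w, hw1, hwsnd, hWw, U, hUmem, fun i j => ?_, hNU, hGw⟩
  split_ifs with hij
  · rw [← hij, hUU, trace_one, Fintype.card_fin, inv_mul_cancel₀ hdC]
  · have hinner : star ((U i ⊗ₖ (1 : Mat (Fin d))) *ᵥ w) ⬝ᵥ ((U j ⊗ₖ (1 : Mat (Fin d))) *ᵥ w) =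
        ((d : ℂ))⁻¹ * ((U i)ᴴ * U j).trace := by
      rw [star_mulVec, ← dotProduct_mulVec, mulVec_mulVec, conjTranspose_kronecker,
        ← mul_kronecker_mul, conjTranspose_one, Matrix.one_mul, dotProduct_kronecker_mulVec, hwsnd,
        Matrix.mul_smul, Matrix.mul_one, trace_smul, smul_eq_mul]
    have h0 := hdc j i
    rw [if_neg (Ne.symm hij), hNW, trace_mul_outer, hGw, outer_mulVec, dotProduct_smul,
      smul_eq_mul, star_dotProduct ((U j ⊗ₖ (1 : Mat (Fin d))) *ᵥ w), hinner] at h0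
    simpa using h0

end EntInvPaper
end
end
end

section
/- Entanglement-invertibility forces equal dimensions. Let A =∏_{i<m} M_{a_i}(ℂ) and B = ∏_{j<n} M_{b_j}(ℂ) be multimatrix algebras, let h₁, h₂ ≥ 1, and let W ∈ M_{h₁}(ℂ)⊗M_{h₂}(ℂ) be any state. If there exists a channel M : A⊗M_{h₁}(ℂ) → B which is entanglement-invertible with respect to W, then dim A = dim B, i.e. ∑_{i<m} a_i² = ∑_{j<n} b_j². -/
noncomputable section

open Matrix Kronecker
open scoped ComplexOrder

noncomputable section

open Matrix Kronecker
open scoped ComplexOrder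

namespace EntInvPaper

/-- Amplification `Φ ⊗ id_{M_t}` for a linear map between multimatrix algebras. -/
def piAmplR {ι κ : Type} {A : ι → Type} {B : κ → Type} (t : Type)
    (Φ : ((i : ι) → Mat (A i)) →ₗ[ℂ] (j : κ) → Mat (B j))
    (X : (i : ι) → Mat (A i × t)) : (j : κ) → Mat (B j × t) :=
  fun j => Matrix.of fun p q =>
    Φ (fun i => Matrix.of fun x y => X i (x, p.2) (y, q.2)) j p.1 q.1

/-- Amplification `id_{M_t} ⊗ Φ` for a linear map between multimatrix algebras. -/
def piAmplL {ι κ : Type} {A : ι → Type} {B : κ → Type} (t : Type)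
    (Φ : ((i : ι) → Mat (A i)) →ₗ[ℂ] (j : κ) → Mat (B j))
    (X : (i : ι) → Mat (t × A i)) : (j : κ) → Mat (t × B j) :=
  fun j => Matrix.of fun p q =>
    Φ (fun i => Matrix.of fun x y => X i (p.1, x) (q.1, y)) j p.2 q.2

/-- Complete positivity for maps between multimatrix algebras. -/
def PiIsCP {ι κ : Type} {A : ι → Type} {B : κ → Type}
    [∀ i, Fintype (A i)] [∀ j, Fintype (B j)]
    (Φ : ((i : ι) → Mat (A i)) →ₗ[ℂ] (j : κ) → Mat (B j)) : Prop :=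
  ∀ (k : ℕ) (X : (i : ι) → Mat (Fin k × A i)),
    (∀ i, (X i).PosSemidef) → ∀ j, (piAmplL (Fin k) Φ X j).PosSemidef

/-- A channel between multimatrix algebras: completely positive and preserving
the total trace. -/
def PiIsChannel {ι κ : Type} [Fintype ι] [Fintype κ] {A : ι → Type} {B : κ → Type}
    [∀ i, Fintype (A i)] [∀ j, Fintype (B j)]
    (Φ : ((i : ι) → Mat (A i)) →ₗ[ℂ] (j : κ) → Mat (B j)) : Prop :=
  PiIsCP Φ ∧ ∀ X, ∑ j, (Φ X j).trace = ∑ i, (X i).trace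

/-- A positive semidefinite element of a multimatrix algebra of total trace one. -/
def PiIsState {ι : Type} [Fintype ι] {A : ι → Type} [∀ i, Fintype (A i)]
    (ρ : (i : ι) → Mat (A i)) : Prop :=
  (∀ i, (ρ i).PosSemidef) ∧ ∑ i, (ρ i).trace = 1

/-- `N` is an entanglement-left inverse of `M : A ⊗ M_{h₁} → B` with respect to
the resource state `W`. -/
def PiEntLeftInv {m n h₁ h₂ : ℕ} {a : Fin m → ℕ} {b : Fin n → ℕ}
    (M : ((i : Fin m) → Mat (Fin (a i) × Fin h₁)) →ₗ[ℂ] (j : Fin n) → Mat (Fin (b j)))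
    (N : ((j : Fin n) → Mat (Fin (b j) × Fin h₂)) →ₗ[ℂ] (i : Fin m) → Mat (Fin (a i)))
    (W : Mat (Fin h₁ × Fin h₂)) : Prop :=
  ∀ x : (i : Fin m) → Mat (Fin (a i)),
    N (piAmplR (Fin h₂) M fun i => tensorState (x i) W) = x

/-- `N` is an entanglement-right inverse of `M` with respect to `W`. -/
def PiEntRightInv {m n h₁ h₂ : ℕ} {a : Fin m → ℕ} {b : Fin n → ℕ}
    (M : ((i : Fin m) → Mat (Fin (a i) × Fin h₁)) →ₗ[ℂ] (j : Fin n) → Mat (Fin (b j)))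
    (N : ((j : Fin n) → Mat (Fin (b j) × Fin h₂)) →ₗ[ℂ] (i : Fin m) → Mat (Fin (a i)))
    (W : Mat (Fin h₁ × Fin h₂)) : Prop :=
  ∀ y : (j : Fin n) → Mat (Fin (b j)),
    M (piAmplR (Fin h₁) N fun j => tensorState (y j) (swapState W)) = y

/-- `M` is entanglement-reversible with respect to `W`. -/
def PiEntReversible {m n h₁ h₂ : ℕ} {a : Fin m → ℕ} {b : Fin n → ℕ}
    (M : ((i : Fin m) → Mat (Fin (a i) × Fin h₁)) →ₗ[ℂ] (j : Fin n) → Mat (Fin (b j)))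
    (W : Mat (Fin h₁ × Fin h₂)) : Prop :=
  ∃ N : ((j : Fin n) → Mat (Fin (b j) × Fin h₂)) →ₗ[ℂ] (i : Fin m) → Mat (Fin (a i)),
    PiIsChannel N ∧ PiEntLeftInv M N W

/-- `M` is entanglement-invertible with respect to `W`. -/
def PiEntInvertible {m n h₁ h₂ : ℕ} {a : Fin m → ℕ} {b : Fin n → ℕ}
    (M : ((i : Fin m) → Mat (Fin (a i) × Fin h₁)) →ₗ[ℂ] (j : Fin n) → Mat (Fin (b j)))
    (W : Mat (Fin h₁ × Fin h₂)) : Prop :=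
  ∃ N : ((j : Fin n) → Mat (Fin (b j) × Fin h₂)) →ₗ[ℂ] (i : Fin m) → Mat (Fin (a i)),
    PiIsChannel N ∧ PiEntLeftInv M N W ∧ PiEntRightInv M N W

end EntInvPaper

noncomputable section
open Matrix Kronecker
open scoped ComplexOrder
namespace EntInvPaper

/-- A completely positive map stays positive under amplification by any finite index type. -/
theorem PiIsCP.posSemidef_piAmplL {ι κ : Type} {A : ι → Type} {B : κ → Type}
    [∀ i, Fintype (A i)] [∀ j, Fintype (B j)]
    {Φ : ((i : ι) → Mat (A i)) →ₗ[ℂ] (j : κ) → Mat (B j)} (hΦ : PiIsCP Φ)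
    {t : Type} [Fintype t] (X : (i : ι) → Mat (t × A i)) (hX : ∀ i, (X i).PosSemidef) (j : κ) :
    (piAmplL t Φ X j).PosSemidef := by
  let e := Fintype.equivFin t
  have h := hΦ (Fintype.card t)
    (fun i => (X i).submatrix (fun p => (e.symm p.1, p.2)) (fun p => (e.symm p.1, p.2)))
    (fun i => (hX i).submatrix _) j
  convert h.submatrix (fun p : t × B j => (e p.1, p.2)) using 1
  ext p q
  simp [piAmplL]

/-- The partial trace of a positive semidefinite matrix is positive semidefinite. -/
theorem posSemidef_ptraceSnd {s t : Type} [Fintype s] [Fintype t] {X : Mat (s × t)}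
    (hX : X.PosSemidef) : (ptraceSnd X).PosSemidef := by
  have h : ptraceSnd X = ∑ k : t, X.submatrix (fun i => (i, k)) (fun i => (i, k)) := by
    ext i i'
    simp [ptraceSnd, Matrix.sum_apply]
  rw [h]
  exact Matrix.posSemidef_sum _ fun k _ => hX.submatrix _

/-- A positive semidefinite `X ∈ M_s ⊗ M_t` satisfies `X ≤ |t| • (Tr_t X ⊗ 1)`. -/
theorem posSemidef_card_smul_ptraceSnd_sub {s t : Type} [Fintype s] [Fintype t]
    [DecidableEq s] [DecidableEq t] {X : Mat (s × t)} (hX : X.PosSemidef) :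
    ((Fintype.card t : ℂ) • (ptraceSnd X ⊗ₖ (1 : Mat t)) - X).PosSemidef := by
  have hconj : ∀ (d : s × t → ℂ) {Y : Mat (s × t)}, Y.PosSemidef →
      (Matrix.diagonal d * Y * (Matrix.diagonal d)ᴴ).PosSemidef :=
    fun d _ hY => hY.mul_mul_conjTranspose_same (Matrix.diagonal d)
  let g : t → s × t → ℂ := fun j p => if p.2 = j then 1 else 0
  have hdiff : (∑ j : t, ∑ k : t, Matrix.diagonal (g j - g k) * X *
      (Matrix.diagonal (g j - g k))ᴴ).PosSemidef :=
    Matrix.posSemidef_sum _ fun j _ => Matrix.posSemidef_sum _ fun k _ => hconj _ hX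
  have hoff : (∑ j : t, ∑ k ∈ Finset.univ.erase j, Matrix.diagonal (g j) *
      X.submatrix (fun p : s × t => (p.1, k)) (fun p : s × t => (p.1, k)) *
      (Matrix.diagonal (g j))ᴴ).PosSemidef :=
    Matrix.posSemidef_sum _ fun j _ => Matrix.posSemidef_sum _ fun k _ =>
      hconj _ (hX.submatrix _)
  have hhalf : (0 : ℂ) ≤ 1 / 2 := by positivity
  have h := (hdiff.smul hhalf).add (hoff.smul (Nat.cast_nonneg (α := ℂ) (Fintype.card t)))
  convert h using 1
  ext ⟨p, u⟩ ⟨q, v⟩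
  have hstar : ∀ j p, (starRingEnd ℂ) (g j p) = g j p := by
    intro j p
    by_cases hp : p.2 = j <;> simp [g, hp]
  have hsum : ∀ p, ∑ j, g j p = 1 := by
    intro p
    simp [g]
  have hmul : ∑ j, g j (p, u) * g j (q, v) = if u = v then 1 else 0 := by
    simp [g, eq_comm]
  have hdiffsum : ∑ j : t, ∑ k : t, (g j (p, u) - g k (p, u)) * X (p, u) (q, v) *
      (g j (q, v) - g k (q, v)) =
      2 * (Fintype.card t * (if u = v then 1 else 0) - 1) * X (p, u) (q, v) := by
    have hcross : ∑ j : t, ∑ k : t, g k (p, u) * g j (q, v) = 1 := by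
      simp [← Finset.sum_mul, hsum]
    have hcoeff : ∑ j : t, ∑ k : t, (g j (p, u) - g k (p, u)) * (g j (q, v) - g k (q, v)) =
        2 * (Fintype.card t * (if u = v then 1 else 0) - 1) := by
      simp only [sub_mul, mul_sub, Finset.sum_sub_distrib, hcross, hmul, Finset.sum_const,
        Finset.card_univ, nsmul_eq_mul, ← Finset.mul_sum, hsum, mul_one]
      ring
    rw [← hcoeff, Finset.sum_mul]
    refine Finset.sum_congr rfl fun j _ => ?_
    rw [Finset.sum_mul]
    exact Finset.sum_congr rfl fun k _ => by ring
  have hoffsum : ∑ j : t, ∑ k ∈ Finset.univ.erase j, g j (p, u) * X (p, k) (q, k) * g j (q, v) =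
      (if u = v then 1 else 0) * (∑ k, X (p, k) (q, k) - X (p, u) (q, v)) := by
    rw [Finset.sum_eq_single u]
    · rw [← Finset.sum_mul, ← Finset.mul_sum, Finset.sum_erase_eq_sub (Finset.mem_univ u)]
      by_cases huv : u = v
      · subst huv
        simp [g]
      · simp [g, huv, Ne.symm huv]
    · intro j _ hj
      simp [g, hj.symm]
    · simp
  simp only [Matrix.add_apply, Matrix.sub_apply, Matrix.smul_apply, Matrix.sum_apply,
    Matrix.diagonal_conjTranspose, Matrix.mul_diagonal, Matrix.diagonal_mul, Pi.sub_apply,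
    Pi.star_apply, RCLike.star_def, map_sub, hstar, Matrix.submatrix_apply, hdiffsum, hoffsum,
    smul_eq_mul, Matrix.kroneckerMap_apply, Matrix.one_apply, ptraceSnd, Matrix.of_apply]
  ring

/-- If `N` recovers every `x` from `(M ⊗ id)(x ⊗ W)`, then `dim A ≤ dim B`. -/
theorem PiEntLeftInv.sum_sq_le {m n h₁ h₂ : ℕ} {a : Fin m → ℕ} {b : Fin n → ℕ}
    {M : ((i : Fin m) → Mat (Fin (a i) × Fin h₁)) →ₗ[ℂ] (j : Fin n) → Mat (Fin (b j))}
    {N : ((j : Fin n) → Mat (Fin (b j) × Fin h₂)) →ₗ[ℂ] (i : Fin m) → Mat (Fin (a i))}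
    {W : Mat (Fin h₁ × Fin h₂)} (hinv : PiEntLeftInv M N W)
    (hM : PiIsChannel M) (hN : PiIsChannel N) (hW : IsState W) :
    ∑ i, (a i) ^ 2 ≤ ∑ j, (b j) ^ 2 := by
  let S := (i : Fin m) × Fin (a i)
  -- the matrix units of `A`, extended by zero to pairs of indices in different blocks
  let e : S → S → (i : Fin m) → Mat (Fin (a i)) := fun P Q i =>
    Matrix.of fun x y => (if P = ⟨i, x⟩ then 1 else 0) * (if Q = ⟨i, y⟩ then 1 else 0)
  let X : (i : Fin m) → Mat ((S × Fin h₂) × (Fin (a i) × Fin h₁)) := fun i =>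
    Matrix.of fun p q => e p.1.1 q.1.1 i p.2.1 q.2.1 * W (p.2.2, p.1.2) (q.2.2, q.1.2)
  have hX : ∀ i, (X i).PosSemidef := by
    intro i
    let ω : S × Fin (a i) → ℂ := fun p => if p.1 = ⟨i, p.2⟩ then 1 else 0
    have h : (Matrix.vecMulVec ω (star ω) ⊗ₖ W).PosSemidef :=
      (Matrix.posSemidef_vecMulVec_self_star ω).kronecker hW.1
    have hXω : X i = (Matrix.vecMulVec ω (star ω) ⊗ₖ W).submatrix
        (fun p => ((p.1.1, p.2.1), (p.2.2, p.1.2)))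
        (fun p => ((p.1.1, p.2.1), (p.2.2, p.1.2))) := by
      ext p q
      simp [X, e, ω, Matrix.vecMulVec_apply, Matrix.kroneckerMap_apply, apply_ite (starRingEnd ℂ)]
    rw [hXω]
    exact h.submatrix _
  let σ := piAmplL (S × Fin h₂) M X
  have hσ : ∀ j, (σ j).PosSemidef := hM.1.posSemidef_piAmplL X hX
  let R : Mat (S × Fin h₂) := ∑ j, ptraceSnd (σ j)
  have hR : R = (1 : Mat S) ⊗ₖ ptraceFst W := by
    ext ⟨P, s⟩ ⟨Q, s'⟩
    have h := hM.2 (fun i => Matrix.of fun p q => X i ((P, s), p) ((Q, s'), q))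
    have h' : R (P, s) (Q, s') = ∑ j, (M (fun i => Matrix.of fun p q =>
        X i ((P, s), p) ((Q, s'), q)) j).trace := by
      simp [R, σ, Matrix.sum_apply, ptraceSnd, piAmplL, Matrix.trace]
    rw [h', h]
    have hdelta : ∑ i, ∑ x, e P Q i x x = if P = Q then 1 else 0 := by
      rw [← Fintype.sum_sigma' (fun i x => e P Q i x x)]
      simp [e]
    have htrace : ∀ i, (Matrix.of fun p q => X i ((P, s), p) ((Q, s'), q)).trace =
        (∑ x, e P Q i x x) * ptraceFst W s s' := by
      intro i
      simp only [Matrix.trace, Matrix.diag_apply, Matrix.of_apply, X, Fintype.sum_prod_type,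
        ptraceFst, Finset.sum_mul_sum]
    simp only [htrace, ← Finset.sum_mul, hdelta, Matrix.kroneckerMap_apply, Matrix.one_apply]
  have hτσ : ∀ j, ((b j : ℂ) • (R ⊗ₖ (1 : Mat (Fin (b j)))) - σ j).PosSemidef := by
    intro j
    have h1 := posSemidef_card_smul_ptraceSnd_sub (hσ j)
    have h2 : (∑ j' ∈ Finset.univ.erase j, ptraceSnd (σ j')).PosSemidef :=
      Matrix.posSemidef_sum _ fun j' _ => posSemidef_ptraceSnd (hσ j')
    have h3 := (h2.kronecker (Matrix.PosSemidef.one (n := Fin (b j)) (R := ℂ))).smul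
      (Nat.cast_nonneg (α := ℂ) (b j))
    convert h1.add h3 using 1
    have hsplit : R = ptraceSnd (σ j) + ∑ j' ∈ Finset.univ.erase j, ptraceSnd (σ j') :=
      (Finset.add_sum_erase _ _ (Finset.mem_univ j)).symm
    rw [hsplit, Matrix.add_kronecker, smul_add, Fintype.card_fin]
    abel
  let T : (j : Fin n) → Mat (Fin (b j) × Fin h₂) := fun j =>
    (b j : ℂ) • ((1 : Mat (Fin (b j))) ⊗ₖ ptraceFst W)
  let Z : (j : Fin n) → Mat (S × (Fin (b j) × Fin h₂)) := fun j =>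
    ((b j : ℂ) • (R ⊗ₖ (1 : Mat (Fin (b j)))) - σ j).submatrix
      (fun p => ((p.1, p.2.2), p.2.1)) (fun p => ((p.1, p.2.2), p.2.1))
  have hNZ := hN.1.posSemidef_piAmplL Z fun j => (hτσ j).submatrix _
  have hZ : ∀ P Q, (fun j => Matrix.of fun x y => Z j (P, x) (Q, y)) =
      (if P = Q then (1 : ℂ) else 0) • T -
        piAmplR (Fin h₂) M fun i => tensorState (e P Q i) W := by
    intro P Q
    funext j
    ext ⟨x, s⟩ ⟨y, s'⟩
    have hM' : σ j ((P, s), x) ((Q, s'), y) =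
        piAmplR (Fin h₂) M (fun i => tensorState (e P Q i) W) j (x, s) (y, s') := rfl
    simp only [Z, T, hR, Matrix.of_apply, Matrix.submatrix_apply, Matrix.sub_apply, hM',
      Pi.sub_apply, Pi.smul_apply, Matrix.smul_apply, smul_eq_mul, Matrix.kroneckerMap_apply,
      Matrix.one_apply]
    ring
  have hnonneg : ∀ i, 0 ≤ (N T i).trace - (a i : ℂ) ^ 2 := by
    intro i
    have h := (hNZ i).submatrix (fun x : Fin (a i) => ((⟨i, x⟩ : S), x))
    have hinj : ∀ x y : Fin (a i), (⟨i, x⟩ : S) = ⟨i, y⟩ ↔ x = y := by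
      simp
    have h1 := h.dotProduct_mulVec_nonneg (fun _ => 1)
    convert h1 using 1
    simp only [dotProduct, Matrix.mulVec, Matrix.submatrix_apply, piAmplL, Matrix.of_apply, hZ,
      map_sub, map_smul, hinv _, Pi.sub_apply, Pi.smul_apply, Matrix.sub_apply, Matrix.smul_apply,
      smul_eq_mul]
    simp [e, hinj, Finset.sum_sub_distrib, Matrix.trace, sq]
  have hsum := Finset.sum_nonneg fun i (_ : i ∈ Finset.univ) => hnonneg i
  rw [Finset.sum_sub_distrib, hN.2] at hsum
  have hW1 : (ptraceFst W).trace = 1 := by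
    rw [← hW.2]
    simp [Matrix.trace, ptraceFst, Fintype.sum_prod_type_right]
  have hT : ∀ j, (T j).trace = (b j : ℂ) ^ 2 := by
    intro j
    simp [T, Matrix.trace_kronecker, hW1, sq]
  simp only [hT, sub_nonneg] at hsum
  exact_mod_cast hsum

/-- **Entanglement-invertibility forces equal dimensions.** If a channel
`M : A ⊗ M_{h₁}(ℂ) → B` between multimatrix algebras is entanglement-invertible
with respect to some state `W`, then `dim A = dim B`. -/
theorem entanglement_invertible_dim_eq
    {m n : ℕ} (a : Fin m → ℕ) (b : Fin n → ℕ)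
    (ha : ∀ i, 1 ≤ a i) (hb : ∀ j, 1 ≤ b j)
    (h₁ h₂ : ℕ) (hh₁ : 1 ≤ h₁) (hh₂ : 1 ≤ h₂)
    (W : Mat (Fin h₁ × Fin h₂)) (hW : IsState W)
    (M : ((i : Fin m) → Mat (Fin (a i) × Fin h₁)) →ₗ[ℂ] (j : Fin n) → Mat (Fin (b j)))
    (hM : PiIsChannel M) (hinv : PiEntInvertible M W) :
    ∑ i, (a i) ^ 2 = ∑ j, (b j) ^ 2 := by
  obtain ⟨N, hN, hleft, hright⟩ := hinv
  have hWσ : IsState (swapState W) := by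
    refine ⟨hW.1.submatrix _, ?_⟩
    rw [← hW.2]
    exact (Equiv.prodComm _ _).symm.sum_comp fun p => W p p
  have hright' : PiEntLeftInv N M (swapState W) := hright
  exact le_antisymm (hleft.sum_sq_le hM hN hW) (hright'.sum_sq_le hN hM hWσ)

end EntInvPaper
end
end
end
end
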